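/- Let x* be a local minimum of the cardinality constrained problem (CCP) at which CC-LICQ holds. Then every point (x*, y) in Z is an S-stationary point of the continuous reformulation, and there exists a unique multiplier triple (λ*, μ*, γ*) ∈ ℝ^m × ℝ^p × ℝ^n which serves as the S-stationary multiplier of (x*, y) for every y with (x*, y) ∈ Z; in particular the multiplier is independent of y. -/

import Mathlib

open Set Filter Topology

noncomputable section

/-- Number of nonzero components of a vector (the "zero norm"). -/
def card0 {n : ℕ} (x : Fin n → ℝ) : ℕ := {i | x i ≠ 0}.ncard

/-- First directional derivative `∇φ(x)ᵀd`. -/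
def D1 {n : ℕ} (φ : (Fin n → ℝ) → ℝ) (x d : Fin n → ℝ) : ℝ := fderiv ℝ φ x d

/-- Second derivative quadratic form `dᵀ∇²φ(x)d`. -/
def D2 {n : ℕ} (φ : (Fin n → ℝ) → ℝ) (x d : Fin n → ℝ) : ℝ :=
  iteratedFDeriv ℝ 2 φ x ![d, d]

/-- Feasibility for the cardinality constrained problem (CCP):
`g(x) ≤ 0`, `h(x) = 0`, `‖x‖₀ ≤ κ`. -/
def CCPFeasible {n m p : ℕ} (g : (Fin n → ℝ) → Fin m → ℝ) (h : (Fin n → ℝ) → Fin p → ℝ)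
    (κ : ℕ) (x : Fin n → ℝ) : Prop :=
  (∀ i, g x i ≤ 0) ∧ (∀ i, h x i = 0) ∧ card0 x ≤ κ

/-- Feasible set `Z` of the continuous reformulation. -/
def ZSet {n m p : ℕ} (g : (Fin n → ℝ) → Fin m → ℝ) (h : (Fin n → ℝ) → Fin p → ℝ)
    (κ : ℕ) : Set ((Fin n → ℝ) × (Fin n → ℝ)) :=
  {z | (∀ i, g z.1 i ≤ 0) ∧ (∀ i, h z.1 i = 0) ∧ (∀ i, 0 ≤ z.2 i) ∧ (∀ i, z.2 i ≤ 1) ∧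
    ((n : ℝ) - (κ : ℝ) ≤ ∑ i, z.2 i) ∧ ∀ i, z.1 i * z.2 i = 0}

/-- `(lam, mu, gam)` is an M-stationary multiplier at `x`. -/
def IsMMult {n m p : ℕ} (f : (Fin n → ℝ) → ℝ) (g : (Fin n → ℝ) → Fin m → ℝ)
    (h : (Fin n → ℝ) → Fin p → ℝ) (x : Fin n → ℝ)
    (lam : Fin m → ℝ) (mu : Fin p → ℝ) (gam : Fin n → ℝ) : Prop :=
  (∀ d, D1 f x d + ∑ i, lam i * D1 (fun x' => g x' i) x d
      + ∑ i, mu i * D1 (fun x' => h x' i) x d + ∑ i, gam i * d i = 0) ∧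
  (∀ i, 0 ≤ lam i) ∧ (∀ i, lam i * g x i = 0) ∧ (∀ i, x i ≠ 0 → gam i = 0)

/-- `(lam, mu, gam)` is an S-stationary multiplier at `(x, y)`. -/
def IsSMult {n m p : ℕ} (f : (Fin n → ℝ) → ℝ) (g : (Fin n → ℝ) → Fin m → ℝ)
    (h : (Fin n → ℝ) → Fin p → ℝ) (x y : Fin n → ℝ)
    (lam : Fin m → ℝ) (mu : Fin p → ℝ) (gam : Fin n → ℝ) : Prop :=
  IsMMult f g h x lam mu gam ∧ ∀ i, x i = 0 → y i = 0 → gam i = 0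

/-- `z` is an M-stationary point of the continuous reformulation. -/
def MStationary {n m p : ℕ} (f : (Fin n → ℝ) → ℝ) (g : (Fin n → ℝ) → Fin m → ℝ)
    (h : (Fin n → ℝ) → Fin p → ℝ) (κ : ℕ) (z : (Fin n → ℝ) × (Fin n → ℝ)) : Prop :=
  z ∈ ZSet g h κ ∧ ∃ lam mu gam, IsMMult f g h z.1 lam mu gam

/-- `z` is an S-stationary point of the continuous reformulation. -/
def SStationary {n m p : ℕ} (f : (Fin n → ℝ) → ℝ) (g : (Fin n → ℝ) → Fin m → ℝ)
    (h : (Fin n → ℝ) → Fin p → ℝ) (κ : ℕ) (z : (Fin n → ℝ) × (Fin n → ℝ)) : Prop :=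
  z ∈ ZSet g h κ ∧ ∃ lam mu gam, IsSMult f g h z.1 z.2 lam mu gam

/-- CC-LICQ at `x`: the active gradients `∇gᵢ(x)` (`gᵢ(x) = 0`), all `∇hᵢ(x)`,
and the unit vectors `eᵢ` (`xᵢ = 0`) are linearly independent. -/
def CCLICQ {n m p : ℕ} (g : (Fin n → ℝ) → Fin m → ℝ) (h : (Fin n → ℝ) → Fin p → ℝ)
    (x : Fin n → ℝ) : Prop :=
  ∀ (lam : Fin m → ℝ) (mu : Fin p → ℝ) (gam : Fin n → ℝ),
    (∀ i, g x i ≠ 0 → lam i = 0) → (∀ i, x i ≠ 0 → gam i = 0) →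
    (∀ d, ∑ i, lam i * D1 (fun x' => g x' i) x d
        + ∑ i, mu i * D1 (fun x' => h x' i) x d + ∑ i, gam i * d i = 0) →
    lam = 0 ∧ mu = 0 ∧ gam = 0

/-- CC-MFCQ at `x`: the active gradients `∇gᵢ(x)` together with all `∇hᵢ(x)` and the
unit vectors `eᵢ` (`xᵢ = 0`) are positively linearly independent. -/
def CCMFCQ {n m p : ℕ} (g : (Fin n → ℝ) → Fin m → ℝ) (h : (Fin n → ℝ) → Fin p → ℝ)
    (x : Fin n → ℝ) : Prop :=
  ∀ (lam : Fin m → ℝ) (mu : Fin p → ℝ) (gam : Fin n → ℝ),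
    (∀ i, 0 ≤ lam i) → (∀ i, g x i ≠ 0 → lam i = 0) → (∀ i, x i ≠ 0 → gam i = 0) →
    (∀ d, ∑ i, lam i * D1 (fun x' => g x' i) x d
        + ∑ i, mu i * D1 (fun x' => h x' i) x d + ∑ i, gam i * d i = 0) →
    lam = 0 ∧ mu = 0 ∧ gam = 0

/-- The linear combination `Σ lamᵢ ∇gᵢ(x) + Σ muᵢ ∇hᵢ(x) + Σ gamᵢ eᵢ` vanishes. -/
def CombZero {n m p : ℕ} (g : (Fin n → ℝ) → Fin m → ℝ) (h : (Fin n → ℝ) → Fin p → ℝ)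
    (lam : Fin m → ℝ) (mu : Fin p → ℝ) (gam : Fin n → ℝ) (x : Fin n → ℝ) : Prop :=
  ∀ d, ∑ i, lam i * D1 (fun x' => g x' i) x d
      + ∑ i, mu i * D1 (fun x' => h x' i) x d + ∑ i, gam i * d i = 0

/-- CC-CPLD at `x`: whenever gradients indexed by subsets of the active sets are
positively linearly dependent at `x`, they remain linearly dependent nearby. -/
def CCCPLD {n m p : ℕ} (g : (Fin n → ℝ) → Fin m → ℝ) (h : (Fin n → ℝ) → Fin p → ℝ)
    (x : Fin n → ℝ) : Prop :=
  ∀ (I1 : Finset (Fin m)) (I2 : Finset (Fin p)) (I3 : Finset (Fin n)),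
    (∀ i ∈ I1, g x i = 0) → (∀ i ∈ I3, x i = 0) →
    (∃ lam mu gam, (∀ i, 0 ≤ lam i) ∧ (∀ i, i ∉ I1 → lam i = 0) ∧ (∀ i, i ∉ I2 → mu i = 0) ∧
      (∀ i, i ∉ I3 → gam i = 0) ∧ ¬(lam = 0 ∧ mu = 0 ∧ gam = 0) ∧ CombZero g h lam mu gam x) →
    ∀ᶠ x' in nhds x, ∃ lam mu gam, (∀ i, i ∉ I1 → lam i = 0) ∧ (∀ i, i ∉ I2 → mu i = 0) ∧
      (∀ i, i ∉ I3 → gam i = 0) ∧ ¬(lam = 0 ∧ mu = 0 ∧ gam = 0) ∧ CombZero g h lam mu gam x'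

/-- The CC-linearisation cone `L_Z(x, y)` (as a predicate on `(dx, dy)`). -/
def LinCone {n m p : ℕ} (g : (Fin n → ℝ) → Fin m → ℝ) (h : (Fin n → ℝ) → Fin p → ℝ)
    (κ : ℕ) (x y dx dy : Fin n → ℝ) : Prop :=
  (∀ i, g x i = 0 → D1 (fun x' => g x' i) x dx ≤ 0) ∧
  (∀ i, D1 (fun x' => h x' i) x dx = 0) ∧
  ((∑ i, y i = (n : ℝ) - (κ : ℝ)) → 0 ≤ ∑ i, dy i) ∧
  (∀ i, x i ≠ 0 → y i = 0 → dy i = 0) ∧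
  (∀ i, x i = 0 → y i = 0 → 0 ≤ dy i) ∧
  (∀ i, x i = 0 → y i = 1 → dy i ≤ 0) ∧
  (∀ i, x i = 0 → 0 < y i → dx i = 0) ∧
  (∀ i, x i = 0 → y i = 0 → dx i * dy i = 0)

/-- The CC-critical cone `C_Z(x, y)`. -/
def CritCone {n m p : ℕ} (f : (Fin n → ℝ) → ℝ) (g : (Fin n → ℝ) → Fin m → ℝ)
    (h : (Fin n → ℝ) → Fin p → ℝ) (κ : ℕ) (x y dx dy : Fin n → ℝ) : Prop :=
  LinCone g h κ x y dx dy ∧ D1 f x dx ≤ 0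

/-- The critical cone `C_X(x)` for the original cardinality constrained problem. -/
def CritConeX {n m p : ℕ} (f : (Fin n → ℝ) → ℝ) (g : (Fin n → ℝ) → Fin m → ℝ)
    (h : (Fin n → ℝ) → Fin p → ℝ) (κ : ℕ) (x dx : Fin n → ℝ) : Prop :=
  (∀ i, g x i = 0 → D1 (fun x' => g x' i) x dx ≤ 0) ∧
  (∀ i, D1 (fun x' => h x' i) x dx = 0) ∧
  (n - κ ≤ {i | x i = 0 ∧ dx i = 0}.ncard) ∧
  D1 f x dx ≤ 0

/-- `x` is a local minimum of the cardinality constrained problem. -/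
def LocalMinCCP {n m p : ℕ} (f : (Fin n → ℝ) → ℝ) (g : (Fin n → ℝ) → Fin m → ℝ)
    (h : (Fin n → ℝ) → Fin p → ℝ) (κ : ℕ) (x : Fin n → ℝ) : Prop :=
  CCPFeasible g h κ x ∧ ∃ r > (0 : ℝ), ∀ x', CCPFeasible g h κ x' → dist x' x < r → f x ≤ f x'

/-- `x` is a strict local minimum of the cardinality constrained problem. -/
def StrictLocalMinCCP {n m p : ℕ} (f : (Fin n → ℝ) → ℝ) (g : (Fin n → ℝ) → Fin m → ℝ)
    (h : (Fin n → ℝ) → Fin p → ℝ) (κ : ℕ) (x : Fin n → ℝ) : Prop :=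
  CCPFeasible g h κ x ∧
    ∃ r > (0 : ℝ), ∀ x', CCPFeasible g h κ x' → dist x' x < r → x' ≠ x → f x < f x'

/-- `z` is a local minimum of the continuous reformulation. -/
def LocalMinZ {n m p : ℕ} (f : (Fin n → ℝ) → ℝ) (g : (Fin n → ℝ) → Fin m → ℝ)
    (h : (Fin n → ℝ) → Fin p → ℝ) (κ : ℕ) (z : (Fin n → ℝ) × (Fin n → ℝ)) : Prop :=
  z ∈ ZSet g h κ ∧ ∃ r > (0 : ℝ), ∀ z' ∈ ZSet g h κ, dist z' z < r → f z.1 ≤ f z'.1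

/-- `z` is a strict local minimum with respect to `x` of the continuous reformulation. -/
def StrictLocalMinX {n m p : ℕ} (f : (Fin n → ℝ) → ℝ) (g : (Fin n → ℝ) → Fin m → ℝ)
    (h : (Fin n → ℝ) → Fin p → ℝ) (κ : ℕ) (z : (Fin n → ℝ) × (Fin n → ℝ)) : Prop :=
  z ∈ ZSet g h κ ∧
    ∃ r > (0 : ℝ), ∀ z' ∈ ZSet g h κ, dist z' z < r → z'.1 ≠ z.1 → f z.1 < f z'.1

/-- Feasible set `Z(t)` of the Scholtes-type regularized program NLP(t). -/
def ZReg {n m p : ℕ} (g : (Fin n → ℝ) → Fin m → ℝ) (h : (Fin n → ℝ) → Fin p → ℝ)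
    (κ : ℕ) (t : ℝ) : Set ((Fin n → ℝ) × (Fin n → ℝ)) :=
  {z | (∀ i, g z.1 i ≤ 0) ∧ (∀ i, h z.1 i = 0) ∧ (∀ i, 0 ≤ z.2 i) ∧ (∀ i, z.2 i ≤ 1) ∧
    ((n : ℝ) - (κ : ℝ) ≤ ∑ i, z.2 i) ∧ (∀ i, z.1 i * z.2 i ≤ t) ∧ ∀ i, -t ≤ z.1 i * z.2 i}

/-- `z` is a local minimum of the regularized program NLP(t). -/
def LocalMinReg {n m p : ℕ} (f : (Fin n → ℝ) → ℝ) (g : (Fin n → ℝ) → Fin m → ℝ)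
    (h : (Fin n → ℝ) → Fin p → ℝ) (κ : ℕ) (t : ℝ) (z : (Fin n → ℝ) × (Fin n → ℝ)) : Prop :=
  z ∈ ZReg g h κ t ∧ ∃ r > (0 : ℝ), ∀ z' ∈ ZReg g h κ t, dist z' z < r → f z.1 ≤ f z'.1

/-- `z` is a KKT point of the regularized program NLP(t). -/
def KKTReg {n m p : ℕ} (f : (Fin n → ℝ) → ℝ) (g : (Fin n → ℝ) → Fin m → ℝ)
    (h : (Fin n → ℝ) → Fin p → ℝ) (κ : ℕ) (t : ℝ) (z : (Fin n → ℝ) × (Fin n → ℝ)) : Prop :=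
  z ∈ ZReg g h κ t ∧
  ∃ (lam : Fin m → ℝ) (mu : Fin p → ℝ) (nu0 nu1 : Fin n → ℝ) (rho : ℝ) (dpl dmi : Fin n → ℝ),
    (∀ d : Fin n → ℝ, D1 f z.1 d + ∑ i, lam i * D1 (fun x' => g x' i) z.1 d
        + ∑ i, mu i * D1 (fun x' => h x' i) z.1 d
        + ∑ i, (dpl i - dmi i) * z.2 i * d i = 0) ∧
    (∀ i, -nu0 i + nu1 i - rho + (dpl i - dmi i) * z.1 i = 0) ∧
    (∀ i, 0 ≤ lam i) ∧ (∀ i, 0 ≤ nu0 i) ∧ (∀ i, 0 ≤ nu1 i) ∧ 0 ≤ rho ∧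
    (∀ i, 0 ≤ dpl i) ∧ (∀ i, 0 ≤ dmi i) ∧
    (∀ i, lam i * g z.1 i = 0) ∧ (∀ i, nu0 i * z.2 i = 0) ∧ (∀ i, nu1 i * (z.2 i - 1) = 0) ∧
    rho * (∑ i, z.2 i - ((n : ℝ) - (κ : ℝ))) = 0 ∧
    (∀ i, dpl i * (z.1 i * z.2 i - t) = 0) ∧ (∀ i, dmi i * (z.1 i * z.2 i + t) = 0)

/-- Standard MFCQ for the regularized program NLP(t) at a feasible point `z`. -/
def MFCQReg {n m p : ℕ} (g : (Fin n → ℝ) → Fin m → ℝ) (h : (Fin n → ℝ) → Fin p → ℝ)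
    (κ : ℕ) (t : ℝ) (z : (Fin n → ℝ) × (Fin n → ℝ)) : Prop :=
  (∀ mu : Fin p → ℝ, (∀ d, ∑ i, mu i * D1 (fun x' => h x' i) z.1 d = 0) → mu = 0) ∧
  ∃ dx dy : Fin n → ℝ,
    (∀ i, D1 (fun x' => h x' i) z.1 dx = 0) ∧
    (∀ i, g z.1 i = 0 → D1 (fun x' => g x' i) z.1 dx < 0) ∧
    (∀ i, z.2 i = 0 → 0 < dy i) ∧
    (∀ i, z.2 i = 1 → dy i < 0) ∧
    (∑ i, z.2 i = (n : ℝ) - (κ : ℝ) → 0 < ∑ i, dy i) ∧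
    (∀ i, z.1 i * z.2 i = t → z.2 i * dx i + z.1 i * dy i < 0) ∧
    (∀ i, z.1 i * z.2 i = -t → 0 < z.2 i * dx i + z.1 i * dy i)

/-- Linearly independent continuous functionals admit a dual family of vectors. -/
lemma exists_dual_family {ι E : Type*} [Fintype ι] [DecidableEq ι] [NormedAddCommGroup E]
    [NormedSpace ℝ E] {F' : ι → E →L[ℝ] ℝ} (hli : LinearIndependent ℝ F') :
    ∃ v : ι → E, ∀ i j, F' i (v j) = if i = j then 1 else 0 := by
  have hsurj : LinearMap.range (LinearMap.pi fun i => (F' i : E →ₗ[ℝ] ℝ)) = ⊤ := by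
    by_contra hne
    obtain ⟨φ, hφ, hle⟩ := Submodule.exists_le_ker_of_lt_top _ (lt_top_iff_ne_top.2 hne)
    have hφ_apply : ∀ w : ι → ℝ, φ w = ∑ i, w i * φ (Pi.single i 1) := fun w => by
      have hφw := LinearMap.pi_apply_eq_sum_univ φ w
      have hsingle : ∀ i : ι, (fun j => if i = j then (1 : ℝ) else 0) = Pi.single i 1 :=
        fun i => by ext j; simp [Pi.single_apply, eq_comm]
      simpa only [hsingle, smul_eq_mul] using hφw
    have hzero : ∑ i, φ (Pi.single i 1) • F' i = 0 := by
      ext d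
      have hd : φ (fun i => F' i d) = 0 := hle ⟨d, rfl⟩
      rw [hφ_apply] at hd
      simpa [mul_comm] using hd
    have hcoef := Fintype.linearIndependent_iff.1 hli _ hzero
    exact hφ (LinearMap.ext fun w => by rw [hφ_apply]; simp [hcoef])
  have hex : ∀ j, ∃ v : E, ∀ i, F' i v = if i = j then 1 else 0 := fun j => by
    obtain ⟨v, hv⟩ := LinearMap.range_eq_top.1 hsurj (Pi.single j 1)
    exact ⟨v, fun i => by simpa [Pi.single_apply] using congrFun hv i⟩
  choose v hv using hex
  exact ⟨v, fun i j => hv j i⟩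

/-- Under linear independence of the constraint derivatives there is a differentiable curve
through `x₀` along which the constraints `F` move affinely in the direction `w`. -/
lemma exists_curve_of_linearIndependent {ι E : Type*} [Fintype ι] [DecidableEq ι]
    [NormedAddCommGroup E] [NormedSpace ℝ E] {F : ι → E → ℝ} {F' : ι → E →L[ℝ] ℝ} {x₀ : E}
    (hF : ∀ i, HasStrictFDerivAt (F i) (F' i) x₀) (hli : LinearIndependent ℝ F') (w : ι → ℝ) :
    ∃ (c : ℝ → E) (d : E), c 0 = x₀ ∧ HasDerivAt c d 0 ∧ (∀ i, F' i d = w i) ∧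
      ∀ᶠ t in 𝓝 (0 : ℝ), ∀ i, F i (c t) = F i x₀ + t * w i := by
  obtain ⟨v, hv⟩ := exists_dual_family hli
  let R : (ι → ℝ) →L[ℝ] E := ∑ j, (ContinuousLinearMap.proj j).smulRight (v j)
  have hR : ∀ i u, F' i (R u) = u i := fun i u => by
    simp [R, hv]
  have hG : HasStrictFDerivAt (fun u i => F i (x₀ + R u))
      ((ContinuousLinearEquiv.refl ℝ (ι → ℝ) : (ι → ℝ) ≃L[ℝ] (ι → ℝ)) :
        (ι → ℝ) →L[ℝ] (ι → ℝ)) 0 := by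
    rw [hasStrictFDerivAt_pi']
    intro i
    have hFi : HasStrictFDerivAt (F i) (F' i) (x₀ + R 0) := by simpa using hF i
    convert hFi.comp (0 : ι → ℝ) (R.hasStrictFDerivAt.const_add x₀) using 1
    ext u
    simp [hR]
  have hinv := hG.to_localInverse
  have hright := hG.eventually_right_inverse
  have hval := hG.localInverse_apply_image
  set L := hG.localInverse
  simp only [map_zero, add_zero] at hinv hright hval
  have hline : HasDerivAt (fun t : ℝ => (fun i => F i x₀) + t • w) w 0 := by
    simpa using ((hasDerivAt_id (0 : ℝ)).smul_const w).const_add (fun i => F i x₀)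
  have hline0 : (fun i => F i x₀) + (0 : ℝ) • w = fun i => F i x₀ := by simp
  refine ⟨fun t => x₀ + R (L ((fun i => F i x₀) + t • w)), R w, ?_, ?_, fun i => hR i w, ?_⟩
  · simp [hval]
  · have hinv' := hinv.hasFDerivAt
    rw [← hline0] at hinv'
    simpa using (R.hasFDerivAt.comp_hasDerivAt (0 : ℝ)
      (hinv'.comp_hasDerivAt (0 : ℝ) hline)).const_add x₀
  · have htend := hline.continuousAt.tendsto
    rw [hline0] at htend
    filter_upwards [htend.eventually hright] with t ht i
    simpa using congrFun ht i

/-- A function with a one-sided local minimum has nonnegative derivative. -/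
lemma HasDerivAt.nonneg_of_eventually_le {u : ℝ → ℝ} {u' a : ℝ} (hu : HasDerivAt u u' a)
    (hmin : ∀ᶠ t in 𝓝[>] a, u a ≤ u t) : 0 ≤ u' := by
  have hslope : Tendsto (slope u a) (𝓝[>] a) (𝓝 u') :=
    (hasDerivAt_iff_tendsto_slope.1 hu).mono_left
      (nhdsWithin_mono a fun t (ht : a < t) => ht.ne')
  refine ge_of_tendsto hslope ?_
  filter_upwards [hmin, self_mem_nhdsWithin] with t ht hta
  rw [slope_def_field]
  exact div_nonneg (sub_nonneg.2 ht) (sub_nonneg.2 (le_of_lt hta))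

/-- Karush–Kuhn–Tucker conditions under linear independence of the derivatives of the active
constraints; `S` is the set of inequality constraints. -/
lemma exists_kkt_multiplier {ι E : Type*} [Fintype ι] [NormedAddCommGroup E] [NormedSpace ℝ E]
    [CompleteSpace E] {F : ι → E → ℝ} {F' : ι → E →L[ℝ] ℝ} {φ : E → ℝ} {φ' : E →L[ℝ] ℝ} {x₀ : E}
    (hF : ∀ i, HasStrictFDerivAt (F i) (F' i) x₀) (hφ : HasStrictFDerivAt φ φ' x₀)
    (hli : LinearIndependent ℝ F') (S : Set ι)
    (hmin : ∀ᶠ x in 𝓝 x₀, (∀ i ∈ S, F i x ≤ F i x₀) → (∀ i ∉ S, F i x = F i x₀) → φ x₀ ≤ φ x) :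
    ∃ Λ : ι → ℝ, φ' + ∑ i, Λ i • F' i = 0 ∧ ∀ i ∈ S, 0 ≤ Λ i := by
  classical
  have hext : IsLocalExtrOn φ {x | ∀ i, F i x = F i x₀} x₀ := by
    left
    filter_upwards [hmin.filter_mono nhdsWithin_le_nhds, self_mem_nhdsWithin] with x hx hxF
    exact hx (fun i _ => (hxF i).le) fun i _ => hxF i
  obtain ⟨Λ, Λ₀, hne, hsum⟩ := hext.exists_multipliers_of_hasStrictFDerivAt hF hφ
  have hΛ₀ : Λ₀ ≠ 0 := by
    rintro rfl
    have hΛ := Fintype.linearIndependent_iff.1 hli Λ (by simpa using hsum)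
    exact hne (Prod.ext (funext hΛ) rfl)
  have hstat : φ' + ∑ i, (Λ₀⁻¹ * Λ i) • F' i = 0 := by
    have hscaled := congrArg (Λ₀⁻¹ • ·) hsum
    simp only [smul_add, smul_zero, Finset.smul_sum, smul_smul, inv_mul_cancel₀ hΛ₀,
      one_smul] at hscaled
    rwa [add_comm]
  refine ⟨fun i => Λ₀⁻¹ * Λ i, hstat, fun j hj => ?_⟩
  obtain ⟨c, d, hc0, hc, hd, hcF⟩ := exists_curve_of_linearIndependent hF hli (-Pi.single j 1)
  have hφc : HasDerivAt (fun t => φ (c t)) (φ' d) 0 := by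
    have hφ' := hφ.hasFDerivAt
    rw [← hc0] at hφ'
    exact hφ'.comp_hasDerivAt 0 hc
  have hnonneg : 0 ≤ φ' d := by
    refine hφc.nonneg_of_eventually_le ?_
    have hcont := hc.continuousAt.tendsto
    rw [hc0] at hcont
    filter_upwards [(hcont.eventually hmin).filter_mono nhdsWithin_le_nhds,
      hcF.filter_mono nhdsWithin_le_nhds, self_mem_nhdsWithin] with t ht htF htpos
    rw [hc0]
    refine ht (fun i _ => ?_) fun i hi => ?_
    · have htpos' : 0 < t := htpos
      rw [htF]
      by_cases hij : i = j
      · subst hij; simp [htpos'.le]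
      · simp [hij]
    · have hij : i ≠ j := fun hij => hi (hij ▸ hj)
      rw [htF]; simp [hij]
  have happ := congrArg (fun T : E →L[ℝ] ℝ => T d) hstat
  simp [hd, Pi.single_apply] at happ
  linarith

lemma sum_dite_zero_mul {α : Type*} [Fintype α] (P : α → Prop) [DecidablePred P]
    (c : {a // P a} → ℝ) (b : α → ℝ) :
    ∑ a, (if ha : P a then c ⟨a, ha⟩ else 0) * b a = ∑ a : {a // P a}, c a * b a := by
  rw [← Fintype.sum_subtype_add_sum_subtype P]
  have hpos : ∀ a : {a // P a}, (if ha : P a then c ⟨a, ha⟩ else 0) * b a = c a * b a :=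
    fun a => by simp [a.2]
  have hneg : ∀ a : {a // ¬P a}, (if ha : P a then c ⟨a, ha⟩ else 0) * b a = 0 :=
    fun a => by simp [a.2]
  simp only [hpos, hneg, Finset.sum_const_zero, add_zero]

/-- A vector vanishing on the support of a feasible `y` satisfies the cardinality constraint. -/
lemma card0_le_of_support {n κ : ℕ} {x y : Fin n → ℝ} (hy1 : ∀ i, y i ≤ 1)
    (hsum : (n : ℝ) - (κ : ℝ) ≤ ∑ i, y i) (hx : ∀ i, y i ≠ 0 → x i = 0) : card0 x ≤ κ := by
  classical
  have hle : ∑ i, y i ≤ ∑ i, ((1 : ℝ) - if x i ≠ 0 then 1 else 0) := by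
    refine Finset.sum_le_sum fun i _ => ?_
    by_cases hxi : x i = 0
    · simpa [hxi] using hy1 i
    · have hyi : y i = 0 := by_contra fun hyi => hxi (hx i hyi)
      simp [hxi, hyi]
  rw [Finset.sum_sub_distrib, Finset.sum_boole] at hle
  simp only [Finset.sum_const, Finset.card_univ, Fintype.card_fin, nsmul_eq_mul, mul_one] at hle
  have hcard : card0 x = (Finset.univ.filter fun i => x i ≠ 0).card := by
    rw [card0, ← Set.ncard_coe_finset]
    congr 1
    ext i
    simp
  rw [hcard]
  exact_mod_cast (by linarith : ((Finset.univ.filter fun i => x i ≠ 0).card : ℝ) ≤ κ)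

/-- Under CC-LICQ there is at most one M-stationary multiplier. -/
lemma IsMMult.unique {n m p : ℕ} {f : (Fin n → ℝ) → ℝ} {g : (Fin n → ℝ) → Fin m → ℝ}
    {h : (Fin n → ℝ) → Fin p → ℝ} {x : Fin n → ℝ} (hlicq : CCLICQ g h x)
    {lam lam' : Fin m → ℝ} {mu mu' : Fin p → ℝ} {gam gam' : Fin n → ℝ}
    (h₁ : IsMMult f g h x lam mu gam) (h₂ : IsMMult f g h x lam' mu' gam') :
    lam = lam' ∧ mu = mu' ∧ gam = gam' := by
  obtain ⟨hs₁, -, hc₁, hz₁⟩ := h₁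
  obtain ⟨hs₂, -, hc₂, hz₂⟩ := h₂
  have hzero := hlicq (lam - lam') (mu - mu') (gam - gam')
    (fun i hi => by
      simp [(mul_eq_zero.1 (hc₁ i)).resolve_right hi, (mul_eq_zero.1 (hc₂ i)).resolve_right hi])
    (fun i hi => by simp [hz₁ i hi, hz₂ i hi])
    (fun d => by
      simp only [Pi.sub_apply, sub_mul, Finset.sum_sub_distrib]
      linarith [hs₁ d, hs₂ d])
  simpa only [sub_eq_zero] using hzero

/-- At a local minimum satisfying CC-LICQ, every feasible `y` admits an S-stationary
multiplier. -/
lemma LocalMinCCP.exists_isSMult {n m p : ℕ} {f : (Fin n → ℝ) → ℝ}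
    {g : (Fin n → ℝ) → Fin m → ℝ} {h : (Fin n → ℝ) → Fin p → ℝ} {κ : ℕ}
    (hf : ContDiff ℝ 1 f) (hg : ∀ i, ContDiff ℝ 1 (fun x => g x i))
    (hh : ∀ i, ContDiff ℝ 1 (fun x => h x i)) {x y : Fin n → ℝ}
    (hmin : LocalMinCCP f g h κ x) (hlicq : CCLICQ g h x) (hy : (x, y) ∈ ZSet g h κ) :
    ∃ lam mu gam, IsSMult f g h x y lam mu gam := by
  classical
  obtain ⟨hgx, hhx, -, hy1, hysum, hxy⟩ := hy
  dsimp only at hgx hhx hy1 hysum hxy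
  obtain ⟨-, r, hr, hloc⟩ := hmin
  have hstrict : ∀ φ : (Fin n → ℝ) → ℝ, ContDiff ℝ 1 φ →
      HasStrictFDerivAt φ (fderiv ℝ φ x) x := fun φ hφ =>
    hφ.contDiffAt.hasStrictFDerivAt one_ne_zero
  let F : {i // g x i = 0} ⊕ Fin p ⊕ {j // y j ≠ 0} → (Fin n → ℝ) → ℝ :=
    Sum.elim (fun i z => g z i) (Sum.elim (fun i z => h z i) fun j z => z j)
  let F' : {i // g x i = 0} ⊕ Fin p ⊕ {j // y j ≠ 0} → (Fin n → ℝ) →L[ℝ] ℝ :=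
    Sum.elim (fun i => fderiv ℝ (fun z => g z i) x)
      (Sum.elim (fun i => fderiv ℝ (fun z => h z i) x)
        fun j => ContinuousLinearMap.proj (j : Fin n))
  have hF : ∀ i, HasStrictFDerivAt (F i) (F' i) x := by
    rintro (i | i | j)
    · exact hstrict _ (hg i)
    · exact hstrict _ (hh i)
    · exact (ContinuousLinearMap.proj (R := ℝ) (φ := fun _ : Fin n => ℝ)
        (j : Fin n)).hasStrictFDerivAt
  have hcomb : ∀ (c : {i // g x i = 0} ⊕ Fin p ⊕ {j // y j ≠ 0} → ℝ) (d : Fin n → ℝ),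
      ∑ i, (if hi : g x i = 0 then c (.inl ⟨i, hi⟩) else 0) * D1 (fun x' => g x' i) x d
        + ∑ i, c (.inr (.inl i)) * D1 (fun x' => h x' i) x d
        + ∑ j, (if hj : y j ≠ 0 then c (.inr (.inr ⟨j, hj⟩)) else 0) * d j
      = (∑ i, c i • F' i) d := fun c d => by
    rw [sum_dite_zero_mul (fun i => g x i = 0) (fun i => c (.inl i)),
      sum_dite_zero_mul (fun j => y j ≠ 0) (fun j => c (.inr (.inr j)))]
    simp [F', D1, add_assoc]
  have hli : LinearIndependent ℝ F' := by
    refine Fintype.linearIndependent_iff.2 fun c hc => ?_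
    obtain ⟨h₁, h₂, h₃⟩ := hlicq _ _ _ (fun i hi => dif_neg hi)
      (fun j hj => dif_neg (not_not.2 ((mul_eq_zero.1 (hxy j)).resolve_left hj)))
      (fun d => by rw [hcomb c d, hc]; rfl)
    rintro (⟨i, hi⟩ | i | ⟨j, hj⟩)
    · simpa [hi] using congrFun h₁ i
    · exact congrFun h₂ i
    · simpa [hj] using congrFun h₃ j
  have hx_support : ∀ j, y j ≠ 0 → x j = 0 := fun j hj => (mul_eq_zero.1 (hxy j)).resolve_right hj
  have hinactive : ∀ᶠ z in 𝓝 x, ∀ i, g x i ≠ 0 → g z i < 0 := by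
    refine eventually_all.2 fun i => ?_
    by_cases hi : g x i = 0
    · simp [hi]
    · filter_upwards [(hg i).continuous.continuousAt.eventually_lt continuousAt_const
        (lt_of_le_of_ne (hgx i) hi)] with z hz _ using hz
  obtain ⟨Λ, hΛ, hΛpos⟩ := exists_kkt_multiplier hF (hstrict f hf) hli (Set.range Sum.inl) (by
    filter_upwards [hinactive, Metric.ball_mem_nhds x hr] with z hz hzr hS hSc
    refine hloc z ⟨fun i => ?_, fun i => ?_, ?_⟩ hzr
    · by_cases hi : g x i = 0
      · exact (hS (.inl ⟨i, hi⟩) ⟨_, rfl⟩).trans (hgx i)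
      · exact (hz i hi).le
    · exact (hSc (.inr (.inl i)) (by simp)).trans (hhx i)
    · exact card0_le_of_support hy1 hysum fun j hj =>
        (hSc (.inr (.inr ⟨j, hj⟩)) (by simp)).trans (hx_support j hj))
  refine ⟨fun i => if hi : g x i = 0 then Λ (.inl ⟨i, hi⟩) else 0, fun i => Λ (.inr (.inl i)),
    fun j => if hj : y j ≠ 0 then Λ (.inr (.inr ⟨j, hj⟩)) else 0,
    ⟨fun d => ?_, fun i => ?_, fun i => ?_, fun j hj => ?_⟩, fun j _ hj => by simp [hj]⟩
  · have happ := congrArg (fun T : (Fin n → ℝ) →L[ℝ] ℝ => T d) hΛ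
    simp only [add_apply, zero_apply] at happ
    rw [← hcomb Λ d] at happ
    simp only [D1] at happ ⊢
    linarith
  · dsimp only
    split_ifs with hi
    · exact hΛpos _ ⟨_, rfl⟩
    · exact le_rfl
  · by_cases hi : g x i = 0 <;> simp [hi]
  · simp [(mul_eq_zero.1 (hxy j)).resolve_left hj]

theorem stmt0
    {n m p : ℕ} (f : (Fin n → ℝ) → ℝ) (g : (Fin n → ℝ) → Fin m → ℝ)
    (h : (Fin n → ℝ) → Fin p → ℝ) (κ : ℕ)
    (hn : 0 < n) (hm : 0 < m) (hp : 0 < p) (hκ0 : 0 < κ) (hκn : κ < n)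
    (hf : ContDiff ℝ 1 f) (hg : ∀ i, ContDiff ℝ 1 (fun x => g x i))
    (hh : ∀ i, ContDiff ℝ 1 (fun x => h x i))
    (xs : Fin n → ℝ) (hmin : LocalMinCCP f g h κ xs) (hlicq : CCLICQ g h xs) :
    ∃ (lam : Fin m → ℝ) (mu : Fin p → ℝ) (gam : Fin n → ℝ),
      (∀ y, (xs, y) ∈ ZSet g h κ → IsSMult f g h xs y lam mu gam) ∧
      ∀ (lam' : Fin m → ℝ) (mu' : Fin p → ℝ) (gam' : Fin n → ℝ) (y : Fin n → ℝ),
        (xs, y) ∈ ZSet g h κ → IsSMult f g h xs y lam' mu' gam' →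
        lam' = lam ∧ mu' = mu ∧ gam' = gam := by
  by_cases hy : ∃ y, (xs, y) ∈ ZSet g h κ
  · obtain ⟨y₀, hy₀⟩ := hy
    obtain ⟨lam, mu, gam, hS⟩ := hmin.exists_isSMult hf hg hh hlicq hy₀
    refine ⟨lam, mu, gam, fun y hy => ?_, fun lam' mu' gam' y _ hS' => hS'.1.unique hlicq hS.1⟩
    obtain ⟨lam', mu', gam', hS'⟩ := hmin.exists_isSMult hf hg hh hlicq hy
    obtain ⟨rfl, rfl, rfl⟩ := hS'.1.unique hlicq hS.1
    exact hS'
  · push Not at hy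
    exact ⟨0, 0, 0, fun y hy' => absurd hy' (hy y), fun _ _ _ y hy' => absurd hy' (hy y)⟩
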